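/- Let τ be a semistandard Young tableau of shape λ and weight μ. Then X̊_τ = { A ∈ T_μ ∩ n : A_{(i,k)} ∈ O_{λ^{(i,k)}} for all 1 ≤ i ≤ m and all 1 ≤ k ≤ μ_i }; that is, the block-by-block Jordan-type conditions defining X̊_τ are equivalent to the box-by-box Jordan-type conditions on every top-left submatrix A_{(i,k)}. -/

import Mathlib

open scoped BigOperators Classical

noncomputable section

namespace Gov

/-- Extend a vector of length `m` by zeros. -/
def ext {m : ℕ} (f : Fin m → ℕ) : ℕ → ℕ := fun r => if h : r < m then f ⟨r, h⟩ else 0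

/-- Offset of the `a`-th block: `μ_1 + ⋯ + μ_{a-1}`. -/
def off {m : ℕ} (μ : Fin m → ℕ) (a : Fin m) : ℕ :=
  ∑ j ∈ Finset.univ.filter (fun j : Fin m => (j : ℕ) < (a : ℕ)), μ j

/-- Total entry access for a square matrix (zero outside the index range). -/
def ent {N : ℕ} (A : Matrix (Fin N) (Fin N) ℂ) (i j : ℕ) : ℂ :=
  if h : i < N ∧ j < N then A ⟨i, h.1⟩ ⟨j, h.2⟩ else 0

/-- Entries of the Jordan matrix `J_μ`:  `J_μ e_a^b = e_a^{b-1}`. -/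
def Jent {m : ℕ} (μ : Fin m → ℕ) (i j : ℕ) : ℂ :=
  if ∃ a : Fin m, ∃ b : ℕ, b + 1 < μ a ∧ i = off μ a + b ∧ j = off μ a + b + 1 then 1 else 0

/-- Membership in the Mirković–Vybornov slice `T_μ`. -/
def inSlice {m N : ℕ} (μ : Fin m → ℕ) (A : Matrix (Fin N) (Fin N) ℂ) : Prop :=
  ∀ s a : Fin m, ∀ t b : ℕ, t < μ s → b < μ a →
    (t + 1 < μ s ∨ (t + 1 = μ s ∧ μ s ≤ b)) →
    ent A (off μ s + t) (off μ a + b) = Jent μ (off μ s + t) (off μ a + b)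

/-- Upper triangularity. -/
def upperTri {N : ℕ} (A : Matrix (Fin N) (Fin N) ℂ) : Prop :=
  ∀ i j : Fin N, (j : ℕ) < (i : ℕ) → A i j = 0

/-- The top-left `d × d` submatrix. -/
def corner {N : ℕ} (A : Matrix (Fin N) (Fin N) ℂ) (d : ℕ) : Matrix (Fin d) (Fin d) ℂ :=
  fun i j => ent A (i : ℕ) (j : ℕ)

/-- `A` is nilpotent with Jordan type `κ` (a partition with at most `rows` parts):
`rank A^k = Σ_r max(κ_r − k, 0)` for all `k ≥ 1`. -/
def hasType {n : ℕ} (A : Matrix (Fin n) (Fin n) ℂ) (rows : ℕ) (κ : ℕ → ℕ) : Prop :=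
  ∀ k : ℕ, 1 ≤ k → (A ^ k).rank = ∑ r ∈ Finset.range rows, (κ r - k)

/-- A semistandard Young tableau of shape `lam` and weight `μ`, both with at most `m` parts,
with entries in `{1, …, m}` (rows and columns are 0-based; `entry r c = 0` outside the shape). -/
structure Tableau (m : ℕ) (lam μ : Fin m → ℕ) where
  entry : ℕ → ℕ → ℕ
  zeros : ∀ r c : ℕ, ¬ c < ext lam r → entry r c = 0
  entry_pos : ∀ r c : ℕ, c < ext lam r → 1 ≤ entry r c
  entry_le : ∀ r c : ℕ, c < ext lam r → entry r c ≤ m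
  row_weak : ∀ r c c' : ℕ, c ≤ c' → c' < ext lam r → entry r c ≤ entry r c'
  col_strict : ∀ r r' c : ℕ, r < r' → c < ext lam r' → entry r c < entry r' c
  weight : ∀ i : Fin m,
    (∑ r ∈ Finset.range m,
      ((Finset.range (ext lam r)).filter fun c => entry r c = (i : ℕ) + 1).card) = μ i

/-- Row lengths of the shape `λ^{(i)}` of the tableau obtained from `T` by deleting all
entries `> i` (here `i` is 1-based). -/
def shapeRow {m : ℕ} {lam μ : Fin m → ℕ} (T : Tableau m lam μ) (i : ℕ) : ℕ → ℕ :=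
  fun r => ((Finset.range (ext lam r)).filter fun c => 1 ≤ T.entry r c ∧ T.entry r c ≤ i).card

/-- Row lengths of the shape `λ^{(i,k)}` of the tableau obtained from `T` by deleting all
entries `> i` and all but the leftmost `k` entries equal to `i` (here `i` is 1-based). -/
def shapeRowBox {m : ℕ} {lam μ : Fin m → ℕ} (T : Tableau m lam μ) (i k : ℕ) : ℕ → ℕ :=
  fun r => ((Finset.range (ext lam r)).filter fun c =>
    (1 ≤ T.entry r c ∧ T.entry r c < i) ∨ (T.entry r c = i ∧
      ((Finset.range c).filter fun c' => ∃ r' < m, T.entry r' c' = i).card < k)).card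

/-- The matrix variety `X̊_τ`. -/
def Xcirc {m : ℕ} (μ lam : Fin m → ℕ) (N : ℕ) (T : Tableau m lam μ) :
    Set (Matrix (Fin N) (Fin N) ℂ) :=
  { A | inSlice μ A ∧ upperTri A ∧
      ∀ i : Fin m, hasType (corner A (off μ i + μ i)) m (shapeRow T ((i : ℕ) + 1)) }

/-- The Zariski topology on `N × N` complex matrices: closed sets are common zero sets of
families of polynomials in the entries. -/
def mzar (N : ℕ) : TopologicalSpace (Matrix (Fin N) (Fin N) ℂ) :=
  TopologicalSpace.generateFrom
    { U | ∃ p : MvPolynomial (Fin N × Fin N) ℂ,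
        U = { A | MvPolynomial.eval (fun q => A q.1 q.2) p ≠ 0 } }

/-- Zariski closure. -/
def closureZ {N : ℕ} (S : Set (Matrix (Fin N) (Fin N) ℂ)) : Set (Matrix (Fin N) (Fin N) ℂ) :=
  letI := mzar N
  closure S

/-- Irreducibility for the Zariski topology. -/
def isIrreducibleZ {N : ℕ} (S : Set (Matrix (Fin N) (Fin N) ℂ)) : Prop :=
  letI := mzar N
  IsIrreducible S

/-- Irreducible components of a subset: maximal irreducible subsets. -/
def irrCompsZ {N : ℕ} (S : Set (Matrix (Fin N) (Fin N) ℂ)) :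
    Set (Set (Matrix (Fin N) (Fin N) ℂ)) :=
  { C | C ⊆ S ∧ isIrreducibleZ C ∧
      ∀ C', C' ⊆ S → isIrreducibleZ C' → C ⊆ C' → C' = C }

/-- Dimension of a subset: its Krull dimension as a topological space
(with the subspace Zariski topology). -/
def dimZ {N : ℕ} (S : Set (Matrix (Fin N) (Fin N) ℂ)) : WithBot ℕ∞ :=
  letI := mzar N
  topologicalKrullDim S


open scoped Matrix

/-- The vectors of `ℂ^N` supported on the first `d` coordinates. -/
def initialCoords (N d : ℕ) : Submodule ℂ (Fin N → ℂ) where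
  carrier := { v | ∀ i : Fin N, d ≤ (i : ℕ) → v i = 0 }
  add_mem' := by
    intro v w hv hw i hi
    simp [hv i hi, hw i hi]
  zero_mem' := by
    intro i _
    rfl
  smul_mem' := by
    intro c v hv i hi
    simp [hv i hi]

theorem mem_initialCoords {N d : ℕ} {v : Fin N → ℂ} :
    v ∈ initialCoords N d ↔ ∀ i : Fin N, d ≤ (i : ℕ) → v i = 0 :=
  Iff.rfl

theorem initialCoords_mono {N d e : ℕ} (h : d ≤ e) : initialCoords N d ≤ initialCoords N e :=
  fun _ hv i hi => hv i (h.trans hi)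

/-- Extension by zero from `ℂ^d` to `ℂ^N`. -/
def extendZero (d N : ℕ) : (Fin d → ℂ) →ₗ[ℂ] (Fin N → ℂ) where
  toFun v i := if h : (i : ℕ) < d then v ⟨i, h⟩ else 0
  map_add' v w := by
    funext i
    by_cases h : (i : ℕ) < d <;> simp [h]
  map_smul' c v := by
    funext i
    by_cases h : (i : ℕ) < d <;> simp [h]

theorem extendZero_apply {d N : ℕ} (v : Fin d → ℂ) (i : Fin N) :
    extendZero d N v i = if h : (i : ℕ) < d then v ⟨i, h⟩ else 0 :=
  rfl

theorem extendZero_injective {d N : ℕ} (h : d ≤ N) : Function.Injective (extendZero d N) := by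
  intro v w hvw
  funext i
  have hi := congrFun hvw ⟨i, i.isLt.trans_le h⟩
  simpa [extendZero_apply] using hi

theorem range_extendZero {d N : ℕ} (h : d ≤ N) :
    LinearMap.range (extendZero d N) = initialCoords N d := by
  apply le_antisymm
  · rintro _ ⟨v, rfl⟩ i hi
    simp [extendZero_apply, not_lt.mpr hi]
  · intro v hv
    refine ⟨fun i => v ⟨i, i.isLt.trans_le h⟩, ?_⟩
    funext i
    by_cases hi : (i : ℕ) < d
    · simp [extendZero_apply, hi]
    · simp [extendZero_apply, hi, hv i (not_lt.mp hi)]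

theorem mulVecLin_comp_extendZero {d N : ℕ} (h : d ≤ N) {A : Matrix (Fin N) (Fin N) ℂ}
    (hA : upperTri A) :
    A.mulVecLin ∘ₗ extendZero d N = extendZero d N ∘ₗ (corner A d).mulVecLin := by
  obtain ⟨e, rfl⟩ := Nat.exists_eq_add_of_le h
  refine LinearMap.ext fun v => ?_
  funext i
  have hsum : (A.mulVecLin (extendZero d (d + e) v)) i
      = ∑ j : Fin d, A i (Fin.castAdd e j) * v j := by
    simp [Matrix.mulVec, dotProduct, Fin.sum_univ_add, extendZero_apply]
  rw [LinearMap.comp_apply, LinearMap.comp_apply, hsum, extendZero_apply]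
  by_cases hi : (i : ℕ) < d
  · rw [dif_pos hi]
    refine Finset.sum_congr rfl fun j _ => ?_
    have hj : (j : ℕ) < d + e := by omega
    simp only [corner, ent]
    rw [dif_pos ⟨i.isLt, hj⟩]
    rfl
  · rw [dif_neg hi]
    refine Finset.sum_eq_zero fun j _ => ?_
    rw [hA i (Fin.castAdd e j) (by simp; omega), zero_mul]

theorem mulVecLin_pow_comp_extendZero {d N : ℕ} (h : d ≤ N) {A : Matrix (Fin N) (Fin N) ℂ}
    (hA : upperTri A) (j : ℕ) :
    (A ^ j).mulVecLin ∘ₗ extendZero d N = extendZero d N ∘ₗ (corner A d ^ j).mulVecLin := by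
  induction j with
  | zero => simp
  | succ j ih =>
    rw [pow_succ, pow_succ, Matrix.mulVecLin_mul, Matrix.mulVecLin_mul, LinearMap.comp_assoc,
      mulVecLin_comp_extendZero h hA, ← LinearMap.comp_assoc, ih, LinearMap.comp_assoc]

/-- For upper triangular `A`, the rank of a power of a top-left corner is the dimension of the
image of the corresponding coordinate subspace. -/
theorem rank_corner_pow {d N : ℕ} (h : d ≤ N) {A : Matrix (Fin N) (Fin N) ℂ}
    (hA : upperTri A) (j : ℕ) :
    (corner A d ^ j).rank
      = Module.finrank ℂ ((initialCoords N d).map (A ^ j).mulVecLin) := by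
  rw [← range_extendZero h, ← LinearMap.range_comp, mulVecLin_pow_comp_extendZero h hA,
    LinearMap.range_comp,
    ← (Submodule.equivMapOfInjective _ (extendZero_injective h) _).finrank_eq]
  rfl

theorem initialCoords_succ {N d : ℕ} (h : d < N) :
    initialCoords N (d + 1) = initialCoords N d ⊔ Submodule.span ℂ {Pi.single ⟨d, h⟩ 1} := by
  apply le_antisymm
  · intro v hv
    rw [Submodule.mem_sup]
    refine ⟨v - v ⟨d, h⟩ • Pi.single ⟨d, h⟩ 1, ?_, v ⟨d, h⟩ • Pi.single ⟨d, h⟩ 1,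
      Submodule.smul_mem _ _ (Submodule.mem_span_singleton_self _), by simp⟩
    intro i hi
    rcases hi.eq_or_lt with hi | hi
    · obtain rfl : i = ⟨d, h⟩ := Fin.ext hi.symm
      simp
    · have hne : i ≠ ⟨d, h⟩ := fun hid => by simp [hid] at hi
      simp [hv i hi, hne]
  · refine sup_le (initialCoords_mono d.le_succ) ?_
    rw [Submodule.span_singleton_le_iff_mem]
    intro i hi
    have hne : i ≠ ⟨d, h⟩ := fun hid => by simp [hid] at hi
    simp [hne]

theorem map_initialCoords_succ {N d : ℕ} (h : d < N) (L : (Fin N → ℂ) →ₗ[ℂ] (Fin N → ℂ)) :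
    (initialCoords N (d + 1)).map L
      = (initialCoords N d).map L ⊔ Submodule.span ℂ {L (Pi.single ⟨d, h⟩ 1)} := by
  rw [initialCoords_succ h, Submodule.map_sup, Submodule.map_span, Set.image_singleton]

theorem finrank_map_initialCoords_mono {N d : ℕ} (L : (Fin N → ℂ) →ₗ[ℂ] (Fin N → ℂ)) :
    Module.finrank ℂ ((initialCoords N d).map L)
      ≤ Module.finrank ℂ ((initialCoords N (d + 1)).map L) :=
  Submodule.finrank_mono (Submodule.map_mono (initialCoords_mono d.le_succ))

theorem finrank_map_initialCoords_succ_of_mem {N d : ℕ} (h : d < N)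
    {L : (Fin N → ℂ) →ₗ[ℂ] (Fin N → ℂ)}
    (hL : L (Pi.single ⟨d, h⟩ 1) ∈ (initialCoords N d).map L) :
    Module.finrank ℂ ((initialCoords N (d + 1)).map L)
      = Module.finrank ℂ ((initialCoords N d).map L) := by
  rw [map_initialCoords_succ h, sup_eq_left.mpr]
  rwa [Submodule.span_singleton_le_iff_mem]

theorem finrank_map_initialCoords_succ_of_notMem {N d : ℕ} (h : d < N)
    {L : (Fin N → ℂ) →ₗ[ℂ] (Fin N → ℂ)}
    (hL : L (Pi.single ⟨d, h⟩ 1) ∉ (initialCoords N d).map L) :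
    Module.finrank ℂ ((initialCoords N (d + 1)).map L)
      = Module.finrank ℂ ((initialCoords N d).map L) + 1 := by
  rw [map_initialCoords_succ h, Submodule.finrank_sup_span_singleton hL]

theorem finrank_map_initialCoords_succ_le {N d : ℕ} (h : d < N)
    (L : (Fin N → ℂ) →ₗ[ℂ] (Fin N → ℂ)) :
    Module.finrank ℂ ((initialCoords N (d + 1)).map L)
      ≤ Module.finrank ℂ ((initialCoords N d).map L) + 1 := by
  by_cases hL : L (Pi.single ⟨d, h⟩ 1) ∈ (initialCoords N d).map L
  · rw [finrank_map_initialCoords_succ_of_mem h hL]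
    exact Nat.le_succ _
  · rw [finrank_map_initialCoords_succ_of_notMem h hL]

/-- For strictly upper triangular `A` with `A e_{d+1} = e_d + (lower terms)`, if `A ^ j e_{d+1}`
lies in the image of the preceding coordinate subspace, then so does `A ^ j e_d`. -/
theorem pow_mulVec_single_mem {N d : ℕ} {A : Matrix (Fin N) (Fin N) ℂ}
    (hA : ∀ i j : Fin N, (j : ℕ) ≤ (i : ℕ) → A i j = 0) (h : d + 1 < N)
    (hd : A ⟨d, (Nat.lt_succ_self d).trans h⟩ ⟨d + 1, h⟩ = 1) {j : ℕ}
    (hmem : (A ^ j).mulVecLin (Pi.single ⟨d + 1, h⟩ 1)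
      ∈ (initialCoords N (d + 1)).map (A ^ j).mulVecLin) :
    (A ^ j).mulVecLin (Pi.single ⟨d, (Nat.lt_succ_self d).trans h⟩ 1)
      ∈ (initialCoords N d).map (A ^ j).mulVecLin := by
  obtain ⟨w, hw, hwA⟩ := hmem
  have hzero : ∀ i : Fin N, d ≤ (i : ℕ) → (A *ᵥ w) i = 0 := by
    intro i hi
    rw [Matrix.mulVec, dotProduct]
    refine Finset.sum_eq_zero fun p _ => ?_
    by_cases hp : d + 1 ≤ (p : ℕ)
    · rw [hw p hp, mul_zero]
    · rw [hA i p (by omega), zero_mul]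
  have hker : (A ^ j).mulVecLin (A *ᵥ Pi.single ⟨d + 1, h⟩ 1 - A *ᵥ w) = 0 := by
    simp only [Matrix.mulVecLin_apply] at hwA ⊢
    rw [← Matrix.mulVec_sub, Matrix.mulVec_mulVec, ← pow_succ, pow_succ', ← Matrix.mulVec_mulVec,
      Matrix.mulVec_sub, hwA, sub_self, Matrix.mulVec_zero]
  refine ⟨Pi.single ⟨d, (Nat.lt_succ_self d).trans h⟩ 1
    - (A *ᵥ Pi.single ⟨d + 1, h⟩ 1 - A *ᵥ w), ?_, by rw [map_sub, hker, sub_zero]⟩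
  intro i hi
  rw [Pi.sub_apply, Pi.sub_apply, hzero i hi, Matrix.mulVec_single_one]
  rcases hi.eq_or_lt with hi | hi
  · obtain rfl : i = ⟨d, (Nat.lt_succ_self d).trans h⟩ := Fin.ext hi.symm
    simp [hd]
  · have hne : i ≠ ⟨d, (Nat.lt_succ_self d).trans h⟩ := fun hid => by simp [hid] at hi
    simp [hne, hA i ⟨d + 1, h⟩ hi]

theorem upperTri.pow {N : ℕ} {A : Matrix (Fin N) (Fin N) ℂ} (hA : upperTri A) (k : ℕ) :
    upperTri (A ^ k) := by
  have hblock : A.BlockTriangular id := fun i j hij => hA i j hij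
  exact fun i j hij => hblock.pow k hij

theorem upperTri.pow_apply_self {N : ℕ} {A : Matrix (Fin N) (Fin N) ℂ} (hA : upperTri A)
    (k : ℕ) (i : Fin N) : (A ^ k) i i = A i i ^ k := by
  induction k with
  | zero => simp
  | succ k ih =>
    rw [pow_succ, pow_succ, Matrix.mul_apply, Finset.sum_eq_single i, ih]
    · intro p _ hp
      rcases lt_or_gt_of_ne hp with hp | hp
      · rw [hA.pow k i p hp, zero_mul]
      · rw [hA p i hp, mul_zero]
    · simp

theorem corner_self {N : ℕ} (A : Matrix (Fin N) (Fin N) ℂ) : corner A N = A := by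
  ext i j
  simp [corner, ent]

theorem upperTri.apply_eq_zero_of_hasType {N rows : ℕ} {A : Matrix (Fin N) (Fin N) ℂ}
    (hA : upperTri A) {κ : ℕ → ℕ} (hκ : hasType A rows κ) {i j : Fin N} (hij : (j : ℕ) ≤ (i : ℕ)) :
    A i j = 0 := by
  rcases hij.lt_or_eq with hij | hij
  · exact hA i j hij
  · obtain rfl : j = i := Fin.ext hij
    set k := (∑ r ∈ Finset.range rows, κ r) + 1
    have hrank : (A ^ k).rank = 0 := by
      rw [hκ k (Nat.le_add_left _ _)]
      refine Finset.sum_eq_zero fun r hr => ?_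
      have := Finset.single_le_sum (f := κ) (fun _ _ => Nat.zero_le _) hr
      omega
    have hzero : A ^ k = 0 := by
      have hrange := Submodule.finrank_eq_zero.mp hrank
      rw [LinearMap.range_eq_bot] at hrange
      exact Matrix.ext_of_mulVec_single fun p =>
        (LinearMap.congr_fun hrange (Pi.single p 1)).trans (Matrix.zero_mulVec _).symm
    have hdiag := hA.pow_apply_self k j
    rw [hzero, Matrix.zero_apply] at hdiag
    exact pow_eq_zero_iff (Nat.succ_ne_zero _) |>.mp hdiag.symm

/-- A sequence with increments in `{0, 1}` in which an increment `1` is followed only by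
increments `1` is determined by its two end values. -/
theorem eq_add_sub_of_increments {f : ℕ → ℕ} {n : ℕ} (hmono : ∀ k < n, f k ≤ f (k + 1))
    (hle : ∀ k < n, f (k + 1) ≤ f k + 1)
    (hstep : ∀ k, k + 1 < n → f (k + 1) = f k + 1 → f (k + 2) = f (k + 1) + 1) {k : ℕ}
    (hk : k ≤ n) : f k = f 0 + (f n - f 0 - (n - k)) := by
  have hup : ∀ l, k + l ≤ n → f (k + l) ≤ f k + l := by
    intro l
    induction l with
    | zero => simp
    | succ l ih =>
      intro hl
      have h1 := ih (by omega)
      have h2 := hle (k + l) (by omega)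
      rw [← Nat.add_assoc]
      omega
  have hrun : ∀ p, p < k → f (p + 1) = f p + 1 → ∀ l, p + 1 + l ≤ n →
      f (p + 1 + l) = f (p + 1) + l ∧ f (p + 1 + l) = f (p + l) + 1 := by
    intro p _ hp l
    induction l with
    | zero => exact fun _ => ⟨rfl, hp⟩
    | succ l ih =>
      intro hl
      obtain ⟨h1, h2⟩ := ih (by omega)
      have h3 := hstep (p + l) (by omega) (by rw [← h2]; congr 1; omega)
      have e1 : p + 1 + (l + 1) = p + l + 2 := by omega
      have e2 : p + (l + 1) = p + l + 1 := by omega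
      have e3 : p + 1 + l = p + l + 1 := by omega
      rw [e1, e2]
      rw [e3] at h1
      omega
  have hend := hup (n - k) (by omega)
  rw [Nat.add_sub_cancel' hk] at hend
  by_cases hconst : ∀ p < k, f (p + 1) = f p
  · have h0 : ∀ p ≤ k, f p = f 0 := by
      intro p
      induction p with
      | zero => simp
      | succ p ih => exact fun hp => (hconst p hp).trans (ih (by omega))
    have := h0 k le_rfl
    omega
  · push Not at hconst
    obtain ⟨p, hp, hne⟩ := hconst
    have h1 : f (p + 1) = f p + 1 := by
      have := hmono p (by omega)
      have := hle p (by omega)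
      omega
    have hk1 := (hrun p hp h1 (k - (p + 1)) (by omega)).1
    have hn1 := (hrun p hp h1 (n - (p + 1)) (by omega)).1
    rw [Nat.add_sub_cancel' (by omega)] at hk1 hn1
    have h0 : ∀ q ≤ n, f 0 ≤ f q := by
      intro q
      induction q with
      | zero => simp
      | succ q ih => exact fun hq => (ih (by omega)).trans (hmono q hq)
    have := h0 k hk
    omega

theorem card_sub_eq_card_filter {S : Finset ℕ} (hS : ∀ c ∈ S, ∀ c' ≤ c, c' ∈ S) (j : ℕ) :
    S.card - j = (S.filter fun c => j ≤ c).card := by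
  have hrange : S = Finset.range S.card := by
    refine Finset.eq_of_subset_of_card_le (fun c hc => ?_) (by simp)
    have hsub : Finset.range (c + 1) ⊆ S := fun c' hc' =>
      hS c hc c' (Nat.lt_succ_iff.mp (Finset.mem_range.mp hc'))
    have := Finset.card_le_card hsub
    rw [Finset.card_range] at this
    exact Finset.mem_range.mpr this
  have hfilter : (S.filter fun c => j ≤ c) = Finset.Ico j S.card := by
    ext c
    conv_lhs => rw [hrange]
    simp only [Finset.mem_filter, Finset.mem_range, Finset.mem_Ico]
    exact and_comm
  rw [hfilter, Nat.card_Ico]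

/-- Among the `k` smallest elements of `C`, the number of those that are at least `j`. -/
theorem card_filter_rank_lt {C : Finset ℕ} {k : ℕ} (hk : k ≤ C.card) (j : ℕ) :
    (C.filter fun c => ((Finset.range c).filter fun c' => c' ∈ C).card < k ∧ j ≤ c).card
      = (C.filter fun c => j ≤ c).card - (C.card - k) := by
  set idx : ℕ → ℕ := fun c => ((Finset.range c).filter fun c' => c' ∈ C).card with hidx
  have hmono : ∀ c c', c ≤ c' → idx c ≤ idx c' := fun c c' h =>
    Finset.card_le_card (Finset.filter_subset_filter _ (Finset.range_mono h))
  have hstrict : ∀ c ∈ C, ∀ c', c < c' → idx c < idx c' := by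
    intro c hc c' h
    refine Finset.card_lt_card ⟨Finset.filter_subset_filter _ (Finset.range_mono h.le), ?_⟩
    intro hsub
    have hmem : c ∈ (Finset.range c).filter fun c' => c' ∈ C :=
      hsub (Finset.mem_filter.mpr ⟨Finset.mem_range.mpr h, hc⟩)
    simp at hmem
  have hinj : Set.InjOn idx C := by
    intro c hc c' hc' h
    rcases lt_trichotomy c c' with hlt | heq | hlt
    · exact absurd h (hstrict c hc c' hlt).ne
    · exact heq
    · exact absurd h (hstrict c' hc' c hlt).ne'
  have himage : C.image idx = Finset.range C.card := by
    refine Finset.eq_of_subset_of_card_le (fun x hx => ?_)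
      (by rw [Finset.card_image_of_injOn hinj, Finset.card_range])
    obtain ⟨c, hc, rfl⟩ := Finset.mem_image.mp hx
    refine Finset.mem_range.mpr (Finset.card_lt_card ⟨fun c' hc' => (Finset.mem_filter.mp hc').2,
      fun hsub => ?_⟩)
    have hmem := hsub hc
    simp at hmem
  have hle : ∀ c ∈ C, (j ≤ c ↔ idx j ≤ idx c) := fun c hc =>
    ⟨hmono j c, fun h => not_lt.mp fun hlt => (hstrict c hc j hlt).not_ge h⟩
  have hcount : ∀ n ≤ C.card, (C.filter fun c => idx c < n ∧ j ≤ c).card = n - idx j := by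
    intro n hn
    rw [← Finset.card_image_of_injOn (hinj.mono (Finset.coe_subset.mpr (Finset.filter_subset _ _))),
      ← Nat.card_Ico]
    congr 1
    ext x
    simp only [Finset.mem_image, Finset.mem_filter, Finset.mem_Ico]
    constructor
    · rintro ⟨c, ⟨hc, hcn, hjc⟩, rfl⟩
      exact ⟨(hle c hc).mp hjc, hcn⟩
    · rintro ⟨hjx, hxn⟩
      have hx : x ∈ C.image idx := himage ▸ Finset.mem_range.mpr (hxn.trans_le hn)
      obtain ⟨c, hc, rfl⟩ := Finset.mem_image.mp hx
      exact ⟨c, ⟨hc, hxn, (hle c hc).mpr hjx⟩, rfl⟩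
  have hall : (C.filter fun c => j ≤ c) = C.filter fun c => idx c < C.card ∧ j ≤ c := by
    refine Finset.filter_congr fun c hc => ⟨fun h => ⟨?_, h⟩, fun h => h.2⟩
    exact Finset.mem_range.mp (himage ▸ Finset.mem_image_of_mem idx hc)
  rw [hall, hcount k hk, hcount C.card le_rfl]
  omega

section Tableau

variable {m : ℕ} {lam μ : Fin m → ℕ}

/-- The columns of the tableau containing the entry `i`. -/
def entryColumns (T : Tableau m lam μ) (i : ℕ) : Finset ℕ :=
  (Finset.range m).biUnion fun r => (Finset.range (ext lam r)).filter fun c => T.entry r c = i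

theorem mem_entryColumns {T : Tableau m lam μ} {i c : ℕ} (hi : 1 ≤ i) :
    c ∈ entryColumns T i ↔ ∃ r < m, T.entry r c = i := by
  simp only [entryColumns, Finset.mem_biUnion, Finset.mem_range, Finset.mem_filter]
  refine exists_congr fun r => and_congr_right fun _ => ⟨fun h => h.2, fun h => ⟨?_, h⟩⟩
  by_contra hc
  have := T.zeros r c hc
  omega

theorem sum_card_filter_entry (T : Tableau m lam μ) (i : ℕ) (Q : ℕ → Prop)
    [DecidablePred Q] :
    ∑ r ∈ Finset.range m,
        ((Finset.range (ext lam r)).filter fun c => T.entry r c = i ∧ Q c).card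
      = ((entryColumns T i).filter Q).card := by
  rw [entryColumns, Finset.filter_biUnion, Finset.card_biUnion]
  · simp only [Finset.filter_filter]
  · intro r _ r' _ hne
    rw [Function.onFun, Finset.disjoint_left]
    intro c hc hc'
    simp only [Finset.mem_filter, Finset.mem_range] at hc hc'
    rcases lt_or_gt_of_ne hne with h | h
    · have := T.col_strict r r' c h hc'.1.1
      omega
    · have := T.col_strict r' r c h hc.1.1
      omega

theorem card_entryColumns (T : Tableau m lam μ) (i : Fin m) :
    (entryColumns T ((i : ℕ) + 1)).card = μ i := by
  have h := sum_card_filter_entry T ((i : ℕ) + 1) fun _ => True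
  simp only [and_true, Finset.filter_true] at h
  rw [← h, T.weight i]

theorem shapeRow_sub (T : Tableau m lam μ) (i r j : ℕ) :
    shapeRow T i r - j
      = ((Finset.range (ext lam r)).filter fun c =>
          (1 ≤ T.entry r c ∧ T.entry r c ≤ i) ∧ j ≤ c).card := by
  rw [shapeRow, card_sub_eq_card_filter, Finset.filter_filter]
  intro c hc c' hc'
  simp only [Finset.mem_filter, Finset.mem_range] at hc ⊢
  have h1 := T.row_weak r c' c hc' hc.1
  have h2 := T.entry_pos r c' (hc'.trans_lt hc.1)
  omega

theorem shapeRowBox_sub (T : Tableau m lam μ) (i k r j : ℕ) :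
    shapeRowBox T i k r - j
      = ((Finset.range (ext lam r)).filter fun c =>
          ((1 ≤ T.entry r c ∧ T.entry r c < i) ∨ (T.entry r c = i ∧
            ((Finset.range c).filter fun c' => ∃ r' < m, T.entry r' c' = i).card < k))
          ∧ j ≤ c).card := by
  rw [shapeRowBox, card_sub_eq_card_filter, Finset.filter_filter]
  intro c hc c' hc'
  simp only [Finset.mem_filter, Finset.mem_range] at hc ⊢
  have h1 := T.row_weak r c' c hc' hc.1
  have h2 := T.entry_pos r c' (hc'.trans_lt hc.1)
  refine ⟨hc'.trans_lt hc.1, ?_⟩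
  rcases hc.2 with h | ⟨h, hcard⟩
  · exact Or.inl ⟨h2, by omega⟩
  · rcases (h1.trans_eq h).lt_or_eq with h3 | h3
    · exact Or.inl ⟨h2, h3⟩
    · exact Or.inr ⟨h3, (Finset.card_le_card (Finset.filter_subset_filter _
        (Finset.range_mono hc'))).trans_lt hcard⟩

theorem sum_shapeRow_succ_sub (T : Tableau m lam μ) (i j : ℕ) :
    ∑ r ∈ Finset.range m, (shapeRow T (i + 1) r - j)
      = ∑ r ∈ Finset.range m, (shapeRow T i r - j)
        + ((entryColumns T (i + 1)).filter fun c => j ≤ c).card := by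
  rw [← sum_card_filter_entry, ← Finset.sum_add_distrib]
  refine Finset.sum_congr rfl fun r _ => ?_
  rw [shapeRow_sub, shapeRow_sub, ← Finset.card_union_of_disjoint, ← Finset.filter_or]
  · congr 1
    refine Finset.filter_congr fun c _ => ?_
    omega
  · rw [Finset.disjoint_filter]
    omega

theorem sum_shapeRowBox_sub (T : Tableau m lam μ) (i : Fin m) {k : ℕ} (hk : k ≤ μ i) (j : ℕ) :
    ∑ r ∈ Finset.range m, (shapeRowBox T ((i : ℕ) + 1) k r - j)
      = ∑ r ∈ Finset.range m, (shapeRow T (i : ℕ) r - j)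
        + (((entryColumns T ((i : ℕ) + 1)).filter fun c => j ≤ c).card - (μ i - k)) := by
  rw [← card_entryColumns T i] at hk ⊢
  rw [← card_filter_rank_lt hk, ← sum_card_filter_entry, ← Finset.sum_add_distrib]
  refine Finset.sum_congr rfl fun r _ => ?_
  simp only [mem_entryColumns (Nat.le_add_left 1 (i : ℕ))]
  rw [shapeRow_sub, shapeRowBox_sub, ← Finset.card_union_of_disjoint, ← Finset.filter_or]
  · congr 1
    refine Finset.filter_congr fun c _ => ?_
    rw [Nat.lt_succ_iff, or_and_right, and_assoc (a := T.entry r c = _)]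
  · rw [Finset.disjoint_filter]
    intro c _ h1 h2
    omega

theorem sum_shapeRow_zero_sub (T : Tableau m lam μ) (j : ℕ) :
    ∑ r ∈ Finset.range m, (shapeRow T 0 r - j) = 0 := by
  refine Finset.sum_eq_zero fun r _ => ?_
  rw [shapeRow_sub, Finset.card_eq_zero, Finset.filter_eq_empty_iff]
  intro c _
  omega

end Tableau

theorem off_add_self {m : ℕ} (μ : Fin m → ℕ) (i : Fin m) :
    off μ i + μ i = ∑ j ∈ Finset.univ.filter (fun j : Fin m => (j : ℕ) < (i : ℕ) + 1), μ j := by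
  have hinsert : Finset.univ.filter (fun j : Fin m => (j : ℕ) < (i : ℕ) + 1)
      = insert i (Finset.univ.filter fun j : Fin m => (j : ℕ) < (i : ℕ)) := by
    ext j
    simp only [Finset.mem_filter, Finset.mem_univ, true_and, Finset.mem_insert, Fin.ext_iff]
    omega
  rw [hinsert, Finset.sum_insert (by simp), off, add_comm]

theorem off_add_self_le {m : ℕ} (μ : Fin m → ℕ) (i : Fin m) : off μ i + μ i ≤ ∑ j, μ j := by
  rw [off_add_self]
  exact Finset.sum_le_sum_of_subset (Finset.filter_subset _ _)

theorem off_add_self_of_last {m : ℕ} (μ : Fin m → ℕ) (i : Fin m) (hi : (i : ℕ) + 1 = m) :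
    off μ i + μ i = ∑ j, μ j := by
  rw [off_add_self, Finset.filter_true_of_mem]
  intro j _
  omega

theorem inSlice.superdiagonal {m N : ℕ} {μ : Fin m → ℕ} {A : Matrix (Fin N) (Fin N) ℂ}
    (hA : inSlice μ A) {i : Fin m} {k : ℕ} (hk : k + 1 < μ i) (h : off μ i + k + 1 < N) :
    A ⟨off μ i + k, (Nat.lt_succ_self _).trans h⟩ ⟨off μ i + k + 1, h⟩ = 1 := by
  have hent := hA i i k (k + 1) (by omega) hk (Or.inl hk)
  rw [ent, dif_pos ⟨by omega, by omega⟩, Jent, if_pos ⟨i, k, hk, rfl, rfl⟩] at hent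
  exact hent

/-- Within a block, the dimensions of the images of the successive coordinate subspaces under
`A ^ j` are determined by those at the two ends of the block. -/
theorem finrank_map_off_add {m N : ℕ} {μ : Fin m → ℕ} (hN : N = ∑ j, μ j)
    {A : Matrix (Fin N) (Fin N) ℂ} (hslice : inSlice μ A)
    (hA : ∀ i j : Fin N, (j : ℕ) ≤ (i : ℕ) → A i j = 0) (i : Fin m) {k : ℕ} (hk : k ≤ μ i)
    (j : ℕ) :
    Module.finrank ℂ ((initialCoords N (off μ i + k)).map (A ^ j).mulVecLin)
      = Module.finrank ℂ ((initialCoords N (off μ i)).map (A ^ j).mulVecLin)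
        + (Module.finrank ℂ ((initialCoords N (off μ i + μ i)).map (A ^ j).mulVecLin)
          - Module.finrank ℂ ((initialCoords N (off μ i)).map (A ^ j).mulVecLin)
          - (μ i - k)) := by
  have hle : off μ i + μ i ≤ N := hN ▸ off_add_self_le μ i
  refine eq_add_sub_of_increments
    (f := fun k => Module.finrank ℂ ((initialCoords N (off μ i + k)).map (A ^ j).mulVecLin))
    (fun k _ => finrank_map_initialCoords_mono _)
    (fun k hk => finrank_map_initialCoords_succ_le
      ((Nat.add_lt_add_left hk _).trans_le hle) _) (fun k hk hincr => ?_) hk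
  have hlt : off μ i + k + 1 < N := by omega
  refine finrank_map_initialCoords_succ_of_notMem hlt fun hmem => ?_
  have hprev := finrank_map_initialCoords_succ_of_mem ((Nat.lt_succ_self _).trans hlt)
    (pow_mulVec_single_mem hA hlt (hslice.superdiagonal hk hlt) hmem)
  exact absurd (hprev.symm.trans hincr) (Nat.lt_succ_self _).ne

/-- The block-by-block Jordan-type conditions defining `X̊_τ` are
equivalent to the box-by-box Jordan-type conditions on every top-left submatrix
`A_{(i,k)}`. -/
theorem stmt3 (m : ℕ) (hm : 1 ≤ m) (μ : Fin m → ℕ)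
    (hμmono : ∀ i j : Fin m, i ≤ j → μ j ≤ μ i) (hμpos : ∀ i : Fin m, 1 ≤ μ i)
    (N : ℕ) (hN : N = ∑ j, μ j)
    (lam : Fin m → ℕ) (hlammono : ∀ i j : Fin m, i ≤ j → lam j ≤ lam i)
    (hlamsum : ∑ j, lam j = N)
    (T : Tableau m lam μ) :
    Xcirc μ lam N T
      = { A : Matrix (Fin N) (Fin N) ℂ | inSlice μ A ∧ upperTri A ∧
          ∀ i : Fin m, ∀ k : ℕ, 1 ≤ k → k ≤ μ i →
            hasType (corner A (off μ i + k)) m (shapeRowBox T ((i : ℕ) + 1) k) } := by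
  have hbound : ∀ i : Fin m, off μ i + μ i ≤ N := fun i => hN ▸ off_add_self_le μ i
  ext A
  refine and_congr_right fun hslice => and_congr_right fun hA => ⟨fun hX => ?_, fun hX i => ?_⟩
  · have hlast := hX ⟨m - 1, by omega⟩
    rw [off_add_self_of_last μ _ (Nat.sub_add_cancel hm), ← hN, corner_self] at hlast
    have hstrict : ∀ p q : Fin N, (q : ℕ) ≤ (p : ℕ) → A p q = 0 := fun p q hpq =>
      hA.apply_eq_zero_of_hasType hlast hpq
    have hblock : ∀ i : Fin m, ∀ j, 1 ≤ j →
        Module.finrank ℂ ((initialCoords N (off μ i + μ i)).map (A ^ j).mulVecLin)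
          = ∑ r ∈ Finset.range m, (shapeRow T ((i : ℕ) + 1) r - j) := fun i j hj => by
      rw [← rank_corner_pow (hbound i) hA, hX i j hj]
    intro i k _ hk j hj
    have hprev : Module.finrank ℂ ((initialCoords N (off μ i)).map (A ^ j).mulVecLin)
        = ∑ r ∈ Finset.range m, (shapeRow T (i : ℕ) r - j) := by
      obtain ⟨i, hi⟩ := i
      cases i with
      | zero =>
        have hoff : off μ ⟨0, hi⟩ = 0 := by simp [off]
        rw [sum_shapeRow_zero_sub, hoff, ← rank_corner_pow (Nat.zero_le N) hA]
        exact Nat.le_zero.mp ((Matrix.rank_le_width _).trans_eq rfl)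
      | succ i =>
        have hoff : off μ ⟨i + 1, hi⟩ = off μ ⟨i, by omega⟩ + μ ⟨i, by omega⟩ :=
          (off_add_self μ ⟨i, by omega⟩).symm
        rw [hoff, hblock ⟨i, by omega⟩ j hj]
    rw [rank_corner_pow (by have := hbound i; omega) hA, finrank_map_off_add hN hslice hstrict i hk,
      hblock i j hj, hprev, sum_shapeRowBox_sub T i hk, sum_shapeRow_succ_sub,
      Nat.add_sub_cancel_left]
  · intro j hj
    rw [hX i (μ i) (hμpos i) le_rfl j hj, sum_shapeRowBox_sub T i le_rfl, sum_shapeRow_succ_sub,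
      Nat.sub_self, Nat.sub_zero]

end Gov
end
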